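/- arXiv:2502.11622 — 2 statements merged into one kernel-verified Lean document; each statement's English description precedes it below -/
import Mathlib

section
/- Let G be a nonempty finite graph with maximum degree at most d which is a small scale (κ,N)-expander for some κ > 0 and N ∈ ℕ, and let 0 < ε < κ/(2(1+d)+κ). Then for every subset A ⊆ V(G) with |A| ≥ (1−ε)|V(G)|, the induced subgraph G[A] is not (ε,N)-hyperfinite. -/
/-- The edge boundary of a set `F` of vertices, coded as the set of ordered pairs `(u,v)`
with `u ∈ F`, `v ∉ F` and `u ~ v`; these pairs are in bijection with the edges of `G`
having exactly one endpoint in `F`. -/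
def edgeBoundaryPairs {V : Type*} (G : SimpleGraph V) (F : Set V) : Set (V × V) :=
  {p | G.Adj p.1 p.2 ∧ p.1 ∈ F ∧ p.2 ∉ F}

/-- `G` is a small scale `(κ,N)`-expander: every nonempty vertex set `F` with `|F| ≤ N`
satisfies `|∂_G F| ≥ κ|F|`. -/
def SmallScaleExpander {V : Type*} (G : SimpleGraph V) (κ : ℝ) (N : ℕ) : Prop :=
  ∀ F : Finset V, F.Nonempty → F.card ≤ N →
    κ * (F.card : ℝ) ≤ ((edgeBoundaryPairs G (↑F : Set V)).ncard : ℝ)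

/-- `G` is `(ε,k)`-hyperfinite: one can delete a set of at most `ε|V(G)|` edges so that all
remaining connected components have at most `k` vertices. -/
def EpsKHyperfinite {V : Type*} (G : SimpleGraph V) (ε : ℝ) (k : ℕ) : Prop :=
  ∃ E' : Set (Sym2 V), E' ⊆ G.edgeSet ∧ (E'.ncard : ℝ) ≤ ε * (Nat.card V : ℝ) ∧
    ∀ v : V, ({u | (G.deleteEdges E').Reachable v u}).ncard ≤ k

open Classical in
/-- A finite set of unordered pairs is represented by at most twice as many ordered pairs. -/
theorem card_filter_sym2_mk_mem_le {W : Type*} [Fintype W] (E : Set (Sym2 W)) :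
    (Finset.univ.filter fun p : W × W => s(p.1, p.2) ∈ E).card ≤ 2 * E.ncard := by
  rw [Set.ncard_eq_toFinset_card']
  refine Finset.card_le_mul_card_image_of_maps_to (f := fun p : W × W => s(p.1, p.2))
    (fun p hp => by simpa using hp) 2 fun e _ => ?_
  induction e with
  | h x y =>
    refine (Finset.card_le_card (t := {(x, y), (y, x)}) fun p hp => ?_).trans Finset.card_le_two
    obtain ⟨a, b⟩ := p
    simpa using (Finset.mem_filter.1 hp).2

open Classical in
/-- If all degrees are at most `d`, at most `d * |Aᶜ|` adjacent ordered pairs have their second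
entry outside `A`. -/
theorem card_filter_adj_snd_notMem_le {V : Type*} [Fintype V] (G : SimpleGraph V) (d : ℕ)
    (hdeg : ∀ v : V, ({u | G.Adj v u}).ncard ≤ d) (A : Set V) :
    (Finset.univ.filter fun p : V × V => G.Adj p.1 p.2 ∧ p.2 ∉ A).card ≤ d * Aᶜ.ncard := by
  rw [Set.ncard_eq_toFinset_card']
  refine Finset.card_le_mul_card_image_of_maps_to (f := Prod.snd)
    (fun p hp => by simpa using (Finset.mem_filter.1 hp).2.2) d fun v _ => ?_
  refine le_trans ?_ (hdeg v)
  rw [Set.ncard_eq_toFinset_card']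
  refine Finset.card_le_card_of_injOn Prod.fst (fun p hp => ?_) fun p hp q hq h => ?_
  · simp only [Finset.coe_filter, Finset.mem_filter, Finset.mem_univ, true_and,
      Set.mem_ofPred_eq] at hp
    simpa [← hp.2] using hp.1.1.symm
  · exact Prod.ext h ((Finset.mem_filter.1 hp).2.trans (Finset.mem_filter.1 hq).2.symm)

open Classical in
/-- In a small scale expander, if the vertices of `A` are partitioned by `f` into parts of size at
most `N`, then the number of boundary pairs of the parts is at least `κ * |A|`. -/
theorem SmallScaleExpander.mul_ncard_le_card_filter {V ι : Type*} [Fintype V] [Fintype ι]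
    {G : SimpleGraph V} {κ : ℝ} {N : ℕ} (hexp : SmallScaleExpander G κ N) (A : Set V)
    (f : A → ι) (hf : ∀ i, {a | f a = i}.ncard ≤ N) :
    κ * (A.ncard : ℝ) ≤ ((Finset.univ.filter fun p : V × V =>
      G.Adj p.1 p.2 ∧ ∃ h : p.1 ∈ A, ∀ h' : p.2 ∈ A, f ⟨p.1, h⟩ ≠ f ⟨p.2, h'⟩).card : ℝ) := by
  let F : ι → Finset V := fun i =>
    (Finset.univ.filter fun a : A => f a = i).map (Function.Embedding.subtype _)
  have hF (i : ι) (v : V) : v ∈ F i ↔ ∃ h : v ∈ A, f ⟨v, h⟩ = i := by simp [F]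
  have hB (i : ι) (p : V × V) : p ∈ (edgeBoundaryPairs G (↑(F i) : Set V)).toFinset ↔
      G.Adj p.1 p.2 ∧ p.1 ∈ F i ∧ p.2 ∉ F i := Set.mem_toFinset
  have hFN (i : ι) : (F i).card ≤ N := by
    simpa [F, Set.ncard_eq_toFinset_card'] using hf i
  have hA : A.ncard = ∑ i, (F i).card := by
    simp only [F, Finset.card_map]
    rw [← Finset.card_eq_sum_card_fiberwise fun a _ => Finset.mem_coe.2 (Finset.mem_univ (f a)),
      Finset.card_univ, ← Nat.card_eq_fintype_card, Nat.card_coe_set_eq]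
  have hle (i : ι) : κ * ((F i).card : ℝ) ≤
      ((edgeBoundaryPairs G (↑(F i) : Set V)).toFinset.card : ℝ) := by
    rw [← Set.ncard_eq_toFinset_card']
    rcases (F i).eq_empty_or_nonempty with h | h
    · simp [h]
    · exact hexp _ h (hFN i)
  have hdisj : (↑(Finset.univ : Finset ι) : Set ι).PairwiseDisjoint
      fun i => (edgeBoundaryPairs G (↑(F i) : Set V)).toFinset := by
    intro i _ j _ hij
    refine Finset.disjoint_left.2 fun p hp hq => hij ?_
    simp only [hB, hF] at hp hq
    obtain ⟨_, ⟨_, rfl⟩, _⟩ := hp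
    obtain ⟨_, ⟨_, rfl⟩, _⟩ := hq
    rfl
  calc κ * (A.ncard : ℝ) = ∑ i, κ * ((F i).card : ℝ) := by
        rw [hA, Nat.cast_sum, Finset.mul_sum]
    _ ≤ ∑ i, ((edgeBoundaryPairs G (↑(F i) : Set V)).toFinset.card : ℝ) :=
        Finset.sum_le_sum fun i _ => hle i
    _ = ((Finset.univ.biUnion
          fun i => (edgeBoundaryPairs G (↑(F i) : Set V)).toFinset).card : ℝ) := by
        rw [Finset.card_biUnion hdisj, Nat.cast_sum]
    _ ≤ _ := by
        refine Nat.cast_le.2 (Finset.card_le_card fun p hp => ?_)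
        simp only [Finset.mem_biUnion, hB, hF] at hp
        obtain ⟨i, -, hadj, ⟨h, hi⟩, hout⟩ := hp
        exact Finset.mem_filter.2
          ⟨Finset.mem_univ _, hadj, h, fun h' heq => hout ⟨h', heq ▸ hi⟩⟩

/-- Proposition: a small scale `(κ,N)`-expander of maximum degree at most `d`, restricted to
any vertex subset of proportion at least `1 − ε` where `0 < ε < κ/(2(1+d)+κ)`, is not
`(ε,N)`-hyperfinite. -/
theorem induced_subgraph_of_expander_not_hyperfinite
    {V : Type*} [Fintype V] [Nonempty V] (G : SimpleGraph V)
    (d : ℕ) (hdeg : ∀ v : V, ({u | G.Adj v u}).ncard ≤ d)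
    {κ : ℝ} (hκ : 0 < κ) (N : ℕ) (hexp : SmallScaleExpander G κ N)
    {ε : ℝ} (hε0 : 0 < ε) (hε : ε < κ / (2 * (1 + d) + κ))
    (A : Set V) (hA : (1 - ε) * (Nat.card V : ℝ) ≤ (A.ncard : ℝ)) :
    ¬ EpsKHyperfinite (SimpleGraph.induce A G) ε N := by
  classical
  rintro ⟨E, -, hEcard, hcomp⟩
  let H := (SimpleGraph.induce A G).deleteEdges E
  have hfib (c : H.ConnectedComponent) : {a | H.connectedComponentMk a = c}.ncard ≤ N := by
    induction c using SimpleGraph.ConnectedComponent.ind with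
    | h v => simpa [SimpleGraph.ConnectedComponent.eq, SimpleGraph.reachable_comm] using hcomp v
  have hlow := hexp.mul_ncard_le_card_filter A H.connectedComponentMk hfib
  have hsub : (Finset.univ.filter fun p : V × V => G.Adj p.1 p.2 ∧ ∃ h : p.1 ∈ A,
      ∀ h' : p.2 ∈ A, H.connectedComponentMk ⟨p.1, h⟩ ≠ H.connectedComponentMk ⟨p.2, h'⟩) ⊆
      (Finset.univ.filter fun p : V × V => G.Adj p.1 p.2 ∧ p.2 ∉ A) ∪
        (Finset.univ.filter fun p : A × A => s(p.1, p.2) ∈ E).image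
          (Prod.map Subtype.val Subtype.val) := by
    rintro ⟨u, v⟩ hp
    obtain ⟨-, hadj, hu, hne⟩ := Finset.mem_filter.1 hp
    by_cases hv : v ∈ A
    · refine Finset.mem_union_right _ (Finset.mem_image.2 ⟨(⟨u, hu⟩, ⟨v, hv⟩), ?_, rfl⟩)
      refine Finset.mem_filter.2 ⟨Finset.mem_univ _, by_contra fun hE => hne hv ?_⟩
      have hH : H.Adj ⟨u, hu⟩ ⟨v, hv⟩ := SimpleGraph.deleteEdges_adj.2 ⟨hadj, hE⟩
      exact SimpleGraph.ConnectedComponent.sound hH.reachable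
    · exact Finset.mem_union_left _ (Finset.mem_filter.2 ⟨Finset.mem_univ _, hadj, hv⟩)
  have hup := (Finset.card_le_card hsub).trans <| (Finset.card_union_le _ _).trans <|
    add_le_add (card_filter_adj_snd_notMem_le G d hdeg A)
      (Finset.card_image_le.trans (card_filter_sym2_mk_mem_le E))
  have hup' := hlow.trans (Nat.cast_le.2 hup)
  push_cast at hup'
  rw [Nat.card_coe_set_eq] at hEcard
  have hcompl : (A.ncard : ℝ) + (Aᶜ.ncard : ℝ) = (Nat.card V : ℝ) := by
    exact_mod_cast Set.ncard_add_ncard_compl A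
  have hn : (0 : ℝ) < (Nat.card V : ℝ) := Nat.cast_pos.2 Nat.card_pos
  have hd : (0 : ℝ) ≤ d := d.cast_nonneg
  rw [lt_div_iff₀ (by positivity)] at hε
  set n : ℝ := (Nat.card V : ℝ)
  have hout : (d : ℝ) * (Aᶜ.ncard : ℝ) ≤ d * (ε * n) :=
    mul_le_mul_of_nonneg_left (by linarith) hd
  have hin : ε * (A.ncard : ℝ) ≤ ε * n :=
    mul_le_mul_of_nonneg_left (by linarith [(Aᶜ.ncard).cast_nonneg (α := ℝ)]) hε0.le
  have hbig : κ * ((1 - ε) * n) ≤ κ * (A.ncard : ℝ) := mul_le_mul_of_nonneg_left hA hκ.le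
  have hlt := mul_lt_mul_of_pos_right hε hn
  have hdn : 0 ≤ d * (ε * n) := by positivity
  linarith
end

section
/- Let Γ be a countable group and let μ be a Γ-invariant Borel probability measure on 2^Γ (the space of subsets of Γ with the product σ-algebra and the left shift action γ·ω = γω) with μ({ω : e ∈ ω}) > 0. Suppose C : Γ × 2^Γ → 2^Γ is a measurable map satisfying: (Equivariance) C(γg, γ·ω) = γ·C(g, ω) for all γ, g ∈ Γ and ω ∈ 2^Γ, and (Disjointness) for μ-almost every ω, C(g, ω) ∩ C(h, ω) = ∅ for all distinct g, h ∈ ω. Then for μ-almost every ω, the set C(g, ω) is finite for every g ∈ ω. -/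
open MeasureTheory

/-- Lemma: let `μ` be a `Γ`-invariant probability measure on `2^Γ` (coded as `Γ → Bool`,
with the left shift `(γ·ω)(x) = ω(γ⁻¹x)`) of positive intensity, and `C` an equivariantly
and measurably defined family of pairwise disjoint cells `C(g,ω) ⊆ Γ` for `g ∈ ω`. Then
almost surely every cell `C(g,ω)` with `g ∈ ω` is finite. -/
theorem cells_of_invariant_random_subset_finite
    {Γ : Type*} [Group Γ] [Countable Γ]
    (μ : Measure (Γ → Bool)) [IsProbabilityMeasure μ]
    (hinv : ∀ γ : Γ, μ.map (fun ω x => ω (γ⁻¹ * x)) = μ)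
    (hpos : 0 < μ {ω | ω 1 = true})
    (C : Γ → (Γ → Bool) → Γ → Prop)
    (hmeas : ∀ g h : Γ, MeasurableSet {ω | C g ω h})
    (hequiv : ∀ (γ g : Γ) (ω : Γ → Bool) (h : Γ),
      C (γ * g) (fun x => ω (γ⁻¹ * x)) h ↔ C g ω (γ⁻¹ * h))
    (hdisj : ∀ᵐ ω ∂μ, ∀ g h : Γ, g ≠ h → ω g = true → ω h = true →
      ∀ x : Γ, ¬ (C g ω x ∧ C h ω x)) :
    ∀ᵐ ω ∂μ, ∀ g : Γ, ω g = true → {x | C g ω x}.Finite := by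
  let A : Γ → Γ → Set (Γ → Bool) := fun g h => {ω | ω g = true ∧ C g ω h}
  have hA : ∀ g h, MeasurableSet (A g h) := fun g h =>
    (measurableSet_eq_fun (measurable_pi_apply g) measurable_const).inter (hmeas g h)
  have hshift : ∀ γ g h, μ (A (γ * g) (γ * h)) = μ (A g h) := by
    intro γ g h
    have hT : Measurable (fun (ω : Γ → Bool) x => ω (γ⁻¹ * x)) :=
      measurable_pi_lambda _ fun x => measurable_pi_apply _
    conv_lhs => rw [← hinv γ]
    rw [Measure.map_apply hT (hA _ _)]
    congr 1
    ext ω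
    simp [A, hequiv]
  have hle : ∀ g, ∑' h, μ (A h g) ≤ 1 := by
    intro g
    rw [← measure_iUnion₀ _ fun h => (hA h g).nullMeasurableSet]
    · exact prob_le_one
    · intro h k hhk
      refine measure_mono_null ?_ (ae_iff.1 hdisj)
      rintro ω ⟨⟨h₁, h₂⟩, h₃, h₄⟩ H
      exact H h k hhk h₁ h₃ g ⟨h₂, h₄⟩
  have hfin : ∀ g, ∀ᵐ ω ∂μ, {x | ω ∈ A g x}.Finite := by
    intro g
    refine ae_finite_setOfPred_mem (ne_top_of_le_ne_top ENNReal.one_ne_top (le_trans ?_ (hle g)))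
    have hinj : Function.Injective fun x : Γ => g * x⁻¹ * g := by
      intro x y hxy
      simpa using hxy
    refine le_trans (le_of_eq (tsum_congr fun x => ?_))
      (ENNReal.tsum_comp_le_tsum_of_injective hinj fun h => μ (A h g))
    rw [← hshift (g * x⁻¹) g x, inv_mul_cancel_right]
  filter_upwards [ae_all_iff.2 hfin] with ω hω g hg
  exact (hω g).subset fun x hx => ⟨hg, hx⟩
end
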